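/- arXiv:1805.06439 — 9 statements merged into one kernel-verified Lean document; each statement's English description precedes it below -/
import Mathlib

section
/- Let $d \geq 1$, let $v \in \mathbb{R}^d$, let $i \in \{1,\dots,d\}$, and let $c \in \mathbb{R}$. Let $\ell = (v_1,\dots,v_{i-1})$ and $r = (v_{i+1},\dots,v_d)$ be the left and right tails of $v$ about the pivot index $i$, and let $\hat{\ell}$ and $\hat{r}$ denote their isotonic regressions. Define $v^\ast \in \mathbb{R}^d$ by $v^\ast_k = \min(\hat{\ell}_k, c)$ for $k < i$, $v^\ast_i = c$, and $v^\ast_k = \max(\hat{r}_{k-i}, c)$ for $k > i$. Then $v^\ast$ is the unique minimizer of $\lVert \hat{v} - v \rVert^2$ over all $\hat{v} \in \mathbb{R}^d$ satisfying $\hat{v}_1 \leq \hat{v}_2 \leq \dots \leq \hat{v}_d$ and $\hat{v}_i = c$. -/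
/-- First-order optimality: if moving from `l` in the direction `z` by any step in `[0, 1]` does not
decrease the squared distance to `v`, then `z` makes a nonnegative inner product with `l - v`. -/
theorem sum_sub_mul_nonneg_of_forall_step {ι : Type*} (s : Finset ι) (l v z : ι → ℝ)
    (h : ∀ ε : ℝ, 0 ≤ ε → ε ≤ 1 →
      ∑ j ∈ s, (l j - v j) ^ 2 ≤ ∑ j ∈ s, (l j + ε * z j - v j) ^ 2) :
    0 ≤ ∑ j ∈ s, (l j - v j) * z j := by
  by_contra! hA
  set A := ∑ j ∈ s, (l j - v j) * z j with hAdef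
  set B := ∑ j ∈ s, z j ^ 2 with hBdef
  have hB : 0 ≤ B := Finset.sum_nonneg fun j _ => sq_nonneg _
  have hBA : 0 < B - A := by linarith
  have expand (ε : ℝ) : ∑ j ∈ s, (l j + ε * z j - v j) ^ 2 =
      ∑ j ∈ s, (l j - v j) ^ 2 + ε * (2 * A + ε * B) := by
    rw [mul_add, ← mul_assoc, ← mul_assoc, hAdef, hBdef, Finset.mul_sum, Finset.mul_sum,
      ← Finset.sum_add_distrib, ← Finset.sum_add_distrib]
    exact Finset.sum_congr rfl fun j _ => by ring
  have hε : 0 < -A / (B - A) := div_pos (by linarith) hBA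
  have hstep := h (-A / (B - A)) hε.le ((div_le_one hBA).2 (by linarith))
  rw [expand] at hstep
  have hslope : 2 * A + -A / (B - A) * B < 0 := by
    have : 2 * A + -A / (B - A) * B = A * (B - 2 * A) / (B - A) := by
      field_simp
      ring
    rw [this]
    exact div_neg_of_neg_of_pos (mul_neg_of_neg_of_pos hA (by linarith)) hBA
  linarith [mul_neg_of_pos_of_neg hε hslope]

/-- Let `l` be an isotonic regression of `v` on `s`, and let `φ` be a monotone map such that
`x - φ x` is monotone too. If `φ ∘ l` is pointwise a projection of `l` relative to a monotone `u`,
then `φ ∘ l` satisfies the Pythagorean inequality for `u` relative to `v`. -/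
theorem isotonic_clip_pythagorean {ι : Type*} [Preorder ι] (s : Finset ι) (l v u : ι → ℝ)
    (φ : ℝ → ℝ) (hl : MonotoneOn l s)
    (hmin : ∀ u : ι → ℝ, MonotoneOn u s →
      ∑ j ∈ s, (l j - v j) ^ 2 ≤ ∑ j ∈ s, (u j - v j) ^ 2)
    (hu : MonotoneOn u s) (hφ : Monotone φ) (hφ' : Monotone fun x => x - φ x)
    (hproj : ∀ j ∈ s, (l j - φ (l j)) * (u j - φ (l j)) ≤ 0) :
    ∑ j ∈ s, (φ (l j) - v j) ^ 2 + ∑ j ∈ s, (u j - φ (l j)) ^ 2 ≤ ∑ j ∈ s, (u j - v j) ^ 2 := by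
  have hopt : 0 ≤ ∑ j ∈ s, (l j - v j) * (u j - φ (l j)) := by
    refine sum_sub_mul_nonneg_of_forall_step s l v _ fun ε h0 h1 => hmin _ ?_
    intro j hj k hk hjk
    have hlk := hl hj hk hjk
    have h₁ := hφ' hlk
    have h₂ := mul_le_mul_of_nonneg_left (hu hj hk hjk) h0
    have h₃ := mul_le_mul_of_nonneg_left (hφ hlk) (sub_nonneg.2 h1)
    dsimp only at h₁ ⊢
    linarith
  have hpt : ∑ j ∈ s, (l j - φ (l j)) * (u j - φ (l j)) ≤ 0 := Finset.sum_nonpos hproj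
  have hsplit : ∑ j ∈ s, (u j - v j) ^ 2 =
      ∑ j ∈ s, (φ (l j) - v j) ^ 2 + ∑ j ∈ s, (u j - φ (l j)) ^ 2 +
        2 * ∑ j ∈ s, (l j - v j) * (u j - φ (l j)) -
        2 * ∑ j ∈ s, (l j - φ (l j)) * (u j - φ (l j)) := by
    rw [Finset.mul_sum, Finset.mul_sum, ← Finset.sum_add_distrib, ← Finset.sum_add_distrib,
      ← Finset.sum_sub_distrib]
    exact Finset.sum_congr rfl fun j _ => by ring
  linarith

theorem sum_Icc_one_eq_add_pivot (d i : ℕ) (hi1 : 1 ≤ i) (hid : i ≤ d) (f : ℕ → ℝ) :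
    ∑ k ∈ Finset.Icc 1 d, f k =
      ∑ k ∈ Finset.Icc 1 (i - 1), f k + f i + ∑ k ∈ Finset.Icc (i + 1) d, f k := by
  have hunion : Finset.Icc 1 d =
      (Finset.Icc 1 (i - 1) ∪ {i}) ∪ Finset.Icc (i + 1) d := by
    ext k
    simp only [Finset.mem_union, Finset.mem_Icc, Finset.mem_singleton]
    omega
  rw [hunion, Finset.sum_union, Finset.sum_union, Finset.sum_singleton]
  all_goals
    rw [Finset.disjoint_left]
    intro k
    simp only [Finset.mem_union, Finset.mem_Icc, Finset.mem_singleton]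
    omega

theorem monotoneOn_Icc_iff (a b : ℕ) (u : ℕ → ℝ) :
    MonotoneOn u (Finset.Icc a b : Finset ℕ) ↔
      ∀ j k : ℕ, a ≤ j → j ≤ k → k ≤ b → u j ≤ u k := by
  simp only [Finset.coe_Icc]
  exact ⟨fun h j k hj hjk hk => h ⟨hj, hjk.trans hk⟩ ⟨hj.trans hjk, hk⟩ hjk,
    fun h j hj k hk hjk => h j k hj.1 hjk hk.2⟩


/-
STATEMENT 0: Lemma 1 (constrained isotonic regression).
Vectors in ℝ^d are modeled as functions `ℕ → ℝ` with relevant indices `1, …, d`.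
The isotonic regression of the left tail `(v 1, …, v (i-1))` is `lhat`, characterized as
the monotone (on indices 1..i-1) minimizer of the squared error; similarly `rhat` for the
right tail `(v (i+1), …, v d)`.  The clipped vector `vstar` is then the unique minimizer
of `‖vhat - v‖²` over monotone vectors `vhat` with `vhat i = c`.
-/
theorem stmt_0 (d : ℕ) (hd : 1 ≤ d) (v : ℕ → ℝ) (i : ℕ) (hi1 : 1 ≤ i) (hid : i ≤ d) (c : ℝ)
    (lhat rhat : ℕ → ℝ)
    -- `lhat` is the isotonic regression of the left tail (v 1, …, v (i-1)):
    (hlmono : ∀ j k : ℕ, 1 ≤ j → j ≤ k → k ≤ i - 1 → lhat j ≤ lhat k)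
    (hlmin : ∀ u : ℕ → ℝ, (∀ j k : ℕ, 1 ≤ j → j ≤ k → k ≤ i - 1 → u j ≤ u k) →
      ∑ j ∈ Finset.Icc 1 (i - 1), (lhat j - v j) ^ 2 ≤
        ∑ j ∈ Finset.Icc 1 (i - 1), (u j - v j) ^ 2)
    -- `rhat` is the isotonic regression of the right tail (v (i+1), …, v d):
    (hrmono : ∀ j k : ℕ, i + 1 ≤ j → j ≤ k → k ≤ d → rhat j ≤ rhat k)
    (hrmin : ∀ u : ℕ → ℝ, (∀ j k : ℕ, i + 1 ≤ j → j ≤ k → k ≤ d → u j ≤ u k) →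
      ∑ j ∈ Finset.Icc (i + 1) d, (rhat j - v j) ^ 2 ≤
        ∑ j ∈ Finset.Icc (i + 1) d, (u j - v j) ^ 2)
    -- the clipped vector v*:
    (vstar : ℕ → ℝ)
    (hvstar : ∀ k : ℕ,
      vstar k = if k < i then min (lhat k) c else if k = i then c else max (rhat k) c) :
    -- v* is feasible:
    ((∀ j k : ℕ, 1 ≤ j → j ≤ k → k ≤ d → vstar j ≤ vstar k) ∧ vstar i = c) ∧
    -- and v* is the unique minimizer among feasible vectors:
    (∀ u : ℕ → ℝ, (∀ j k : ℕ, 1 ≤ j → j ≤ k → k ≤ d → u j ≤ u k) → u i = c →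
      (∑ k ∈ Finset.Icc 1 d, (vstar k - v k) ^ 2 ≤ ∑ k ∈ Finset.Icc 1 d, (u k - v k) ^ 2) ∧
      ((∃ k ∈ Finset.Icc 1 d, u k ≠ vstar k) →
        ∑ k ∈ Finset.Icc 1 d, (vstar k - v k) ^ 2 < ∑ k ∈ Finset.Icc 1 d, (u k - v k) ^ 2)) := by
  have hleft (k : ℕ) (hk : k < i) : vstar k = min (lhat k) c := by rw [hvstar, if_pos hk]
  have hpivot : vstar i = c := by simp [hvstar]
  have hright (k : ℕ) (hk : i < k) : vstar k = max (rhat k) c := by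
    rw [hvstar, if_neg hk.not_gt, if_neg hk.ne']
  refine ⟨⟨fun j k hj hjk hk => ?_, hpivot⟩, fun u hu huc => ?_⟩
  · rcases lt_trichotomy k i with hki | rfl | hki
    · rw [hleft j (by omega), hleft k hki]
      exact min_le_min_right c (hlmono j k hj hjk (by omega))
    · rcases hjk.lt_or_eq with hjk | rfl
      · rw [hleft j hjk, hpivot]
        exact min_le_right _ _
      · rfl
    · rw [hright k hki]
      rcases lt_trichotomy j i with hji | rfl | hji
      · rw [hleft j hji]
        exact (min_le_right _ _).trans (le_max_right _ _)
      · rw [hpivot]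
        exact le_max_right _ _
      · rw [hright j hji]
        exact max_le_max_right c (hrmono j k hji hjk hk)
  simp only [← monotoneOn_Icc_iff] at hlmin hrmin
  have hL := isotonic_clip_pythagorean (Finset.Icc 1 (i - 1)) lhat v u (fun x => min x c)
    ((monotoneOn_Icc_iff _ _ _).2 hlmono) hlmin
    ((monotoneOn_Icc_iff _ _ _).2 fun j k hj hjk hk => hu j k hj hjk (by omega))
    (fun x y hxy => min_le_min_right c hxy)
    (fun x y hxy => by dsimp only; grind)
    (fun j hj => by
      rw [Finset.mem_Icc] at hj
      have huj : u j ≤ c := huc ▸ hu j i hj.1 (by omega) hid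
      rcases le_total (lhat j) c with h | h
      · simp [h]
      · simp only [min_eq_right h]
        exact mul_nonpos_of_nonneg_of_nonpos (by linarith) (by linarith))
  have hR := isotonic_clip_pythagorean (Finset.Icc (i + 1) d) rhat v u (fun x => max x c)
    ((monotoneOn_Icc_iff _ _ _).2 hrmono) hrmin
    ((monotoneOn_Icc_iff _ _ _).2 fun j k hj hjk hk => hu j k (by omega) hjk hk)
    (fun x y hxy => max_le_max_right c hxy)
    (fun x y hxy => by dsimp only; grind)
    (fun j hj => by
      rw [Finset.mem_Icc] at hj
      have huj : c ≤ u j := huc ▸ hu i j hi1 (by omega) hj.2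
      rcases le_total c (rhat j) with h | h
      · simp [h]
      · simp only [max_eq_right h]
        exact mul_nonpos_of_nonpos_of_nonneg (by linarith) (by linarith))
  have key : ∑ k ∈ Finset.Icc 1 d, (vstar k - v k) ^ 2 +
      ∑ k ∈ Finset.Icc 1 d, (u k - vstar k) ^ 2 ≤ ∑ k ∈ Finset.Icc 1 d, (u k - v k) ^ 2 := by
    have hsumL (F : ℕ → ℝ → ℝ) : ∑ k ∈ Finset.Icc 1 (i - 1), F k (vstar k) =
        ∑ k ∈ Finset.Icc 1 (i - 1), F k (min (lhat k) c) :=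
      Finset.sum_congr rfl fun k hk => by
        rw [Finset.mem_Icc] at hk
        rw [hleft k (by omega)]
    have hsumR (F : ℕ → ℝ → ℝ) : ∑ k ∈ Finset.Icc (i + 1) d, F k (vstar k) =
        ∑ k ∈ Finset.Icc (i + 1) d, F k (max (rhat k) c) :=
      Finset.sum_congr rfl fun k hk => by
        rw [Finset.mem_Icc] at hk
        rw [hright k (by omega)]
    simp only [sum_Icc_one_eq_add_pivot d i hi1 hid, hpivot, huc, sub_self]
    rw [hsumL fun k x => (x - v k) ^ 2, hsumL fun k x => (u k - x) ^ 2,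
      hsumR fun k x => (x - v k) ^ 2, hsumR fun k x => (u k - x) ^ 2]
    linarith
  refine ⟨?_, fun ⟨k, hk, hne⟩ => ?_⟩
  · have : 0 ≤ ∑ k ∈ Finset.Icc 1 d, (u k - vstar k) ^ 2 :=
      Finset.sum_nonneg fun k _ => sq_nonneg _
    linarith
  · have : 0 < ∑ k ∈ Finset.Icc 1 d, (u k - vstar k) ^ 2 :=
      Finset.sum_pos' (fun k _ => sq_nonneg _) ⟨k, hk, sq_pos_of_ne_zero (sub_ne_zero.2 hne)⟩
    linarith
end

section
/- Let $m \geq 1$, let $w \in \mathbb{R}^m$ with isotonic regression $\hat{w}$, and let $c \in \mathbb{R}$. Then the vector $w^\ast$ with entries $w^\ast_k = \min(\hat{w}_k, c)$ is the unique minimizer of $\lVert u - w \rVert^2$ over all monotone vectors $u$ (i.e., $u_1 \leq \dots \leq u_m$) satisfying the upper-bound constraint $u_m \leq c$. -/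
/-- If `t * r + t ^ 2 * s ≥ 0` for all `t ∈ (0, 1]`, then `r ≥ 0`. -/
lemma nonneg_of_forall_mul_add_sq_mul_nonneg {r s : ℝ}
    (h : ∀ t : ℝ, 0 < t → t ≤ 1 → 0 ≤ t * r + t ^ 2 * s) : 0 ≤ r := by
  by_contra! hr
  have hd : 0 < |s| - r := by linarith [abs_nonneg s]
  have ht : 0 < -r / (2 * (|s| - r)) := div_pos (by linarith) (by linarith)
  have ht1 : -r / (2 * (|s| - r)) ≤ 1 := by
    rw [div_le_one (by linarith)]
    linarith [abs_nonneg s]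
  have hval : -r / (2 * (|s| - r)) * (|s| - r) = -r / 2 := by field_simp
  have key := h _ ht ht1
  generalize -r / (2 * (|s| - r)) = t at *
  have hle : 0 ≤ r + t * s := by
    refine nonneg_of_mul_nonneg_right (b := r + t * s) ?_ ht
    linarith
  nlinarith [mul_le_mul_of_nonneg_left (le_abs_self s) ht.le]

/-- First-order optimality along a direction in which a minimizer of the squared error can be
moved by any step in `(0, 1]`. -/
lemma sum_sub_mul_nonneg_of_forall_le {ι : Type*} (s : Finset ι) (a w d : ι → ℝ)
    (h : ∀ t : ℝ, 0 < t → t ≤ 1 →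
      ∑ i ∈ s, (a i - w i) ^ 2 ≤ ∑ i ∈ s, (a i + t * d i - w i) ^ 2) :
    0 ≤ ∑ i ∈ s, (a i - w i) * d i := by
  have h2 : 0 ≤ 2 * ∑ i ∈ s, (a i - w i) * d i := by
    refine nonneg_of_forall_mul_add_sq_mul_nonneg (s := ∑ i ∈ s, d i ^ 2) fun t ht ht1 => ?_
    have hexp : ∑ i ∈ s, (a i + t * d i - w i) ^ 2 = ∑ i ∈ s, (a i - w i) ^ 2 +
        (t * (2 * ∑ i ∈ s, (a i - w i) * d i) + t ^ 2 * ∑ i ∈ s, d i ^ 2) := by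
      simp only [Finset.mul_sum, ← Finset.sum_add_distrib]
      exact Finset.sum_congr rfl fun i _ => by ring
    linarith [h t ht ht1]
  linarith

/-
STATEMENT 2: clipping the isotonic regression from above gives the unique minimizer
of the squared error over monotone vectors with an upper-bound constraint on the
last entry.  Vectors in ℝ^m are modeled as `ℕ → ℝ` with relevant indices 1..m.
-/
theorem stmt_2 (m : ℕ) (hm : 1 ≤ m) (w : ℕ → ℝ) (c : ℝ) (what : ℕ → ℝ)
    -- `what` is the isotonic regression of w:
    (hmono : ∀ j k : ℕ, 1 ≤ j → j ≤ k → k ≤ m → what j ≤ what k)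
    (hmin : ∀ u : ℕ → ℝ, (∀ j k : ℕ, 1 ≤ j → j ≤ k → k ≤ m → u j ≤ u k) →
      ∑ j ∈ Finset.Icc 1 m, (what j - w j) ^ 2 ≤ ∑ j ∈ Finset.Icc 1 m, (u j - w j) ^ 2)
    -- the clipped vector w*:
    (wstar : ℕ → ℝ) (hwstar : ∀ k : ℕ, wstar k = min (what k) c) :
    -- w* is feasible:
    ((∀ j k : ℕ, 1 ≤ j → j ≤ k → k ≤ m → wstar j ≤ wstar k) ∧ wstar m ≤ c) ∧
    -- and w* is the unique minimizer among feasible vectors: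
    (∀ u : ℕ → ℝ, (∀ j k : ℕ, 1 ≤ j → j ≤ k → k ≤ m → u j ≤ u k) → u m ≤ c →
      (∑ k ∈ Finset.Icc 1 m, (wstar k - w k) ^ 2 ≤ ∑ k ∈ Finset.Icc 1 m, (u k - w k) ^ 2) ∧
      ((∃ k ∈ Finset.Icc 1 m, u k ≠ wstar k) →
        ∑ k ∈ Finset.Icc 1 m, (wstar k - w k) ^ 2 < ∑ k ∈ Finset.Icc 1 m, (u k - w k) ^ 2)) := by
  have hfeas : ∀ j k : ℕ, 1 ≤ j → j ≤ k → k ≤ m → wstar j ≤ wstar k := fun j k hj hjk hk => by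
    rw [hwstar, hwstar]
    exact min_le_min_right c (hmono j k hj hjk hk)
  refine ⟨⟨hfeas, by rw [hwstar]; exact min_le_right _ _⟩, fun u hu huc => ?_⟩
  have hexcess : ∀ j k : ℕ, 1 ≤ j → j ≤ k → k ≤ m →
      what j - wstar j ≤ what k - wstar k := fun j k hj hjk hk => by
    have := hmono j k hj hjk hk
    rw [hwstar, hwstar]
    rcases min_cases (what j) c with h | h <;> rcases min_cases (what k) c with h' | h' <;>
      linarith
  have hvar : 0 ≤ ∑ k ∈ Finset.Icc 1 m, (what k - w k) * (u k - wstar k) := by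
    refine sum_sub_mul_nonneg_of_forall_le _ what w (fun k => u k - wstar k) fun t ht ht1 => ?_
    refine hmin (fun k => what k + t * (u k - wstar k)) fun j k hj hjk hk => ?_
    have h1 := hexcess j k hj hjk hk
    have h2 := mul_le_mul_of_nonneg_left (hu j k hj hjk hk) ht.le
    have h3 := mul_le_mul_of_nonneg_left (hfeas j k hj hjk hk) (sub_nonneg.2 ht1)
    linarith
  have hclip : 0 ≤ ∑ k ∈ Finset.Icc 1 m, (wstar k - what k) * (u k - wstar k) := by
    refine Finset.sum_nonneg fun k hk => ?_
    obtain ⟨hk1, hkm⟩ := Finset.mem_Icc.1 hk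
    have huk : u k ≤ c := (hu k m hk1 hkm le_rfl).trans huc
    rw [hwstar]
    rcases min_cases (what k) c with ⟨h, _⟩ | ⟨h, h'⟩ <;> rw [h]
    · simp
    · exact mul_nonneg_of_nonpos_of_nonpos (by linarith) (by linarith)
  have hexp : ∑ k ∈ Finset.Icc 1 m, (u k - w k) ^ 2 =
      ∑ k ∈ Finset.Icc 1 m, (wstar k - w k) ^ 2 + ∑ k ∈ Finset.Icc 1 m, (u k - wstar k) ^ 2 +
        2 * (∑ k ∈ Finset.Icc 1 m, (what k - w k) * (u k - wstar k) +
          ∑ k ∈ Finset.Icc 1 m, (wstar k - what k) * (u k - wstar k)) := by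
    simp only [← Finset.sum_add_distrib, Finset.mul_sum]
    exact Finset.sum_congr rfl fun k _ => by ring
  refine ⟨?_, fun ⟨k, hk, hne⟩ => ?_⟩
  · have : 0 ≤ ∑ k ∈ Finset.Icc 1 m, (u k - wstar k) ^ 2 :=
      Finset.sum_nonneg fun k _ => sq_nonneg _
    linarith
  · have : 0 < ∑ k ∈ Finset.Icc 1 m, (u k - wstar k) ^ 2 :=
      Finset.sum_pos' (fun k _ => sq_nonneg _) ⟨k, hk, sq_pos_of_ne_zero (sub_ne_zero.2 hne)⟩
    linarith
end

section
/- Let $m \geq 1$, let $w \in \mathbb{R}^m$ with isotonic regression $\hat{w}$, and let $c \in \mathbb{R}$. Then the vector $w^\ast$ with entries $w^\ast_k = \max(\hat{w}_k, c)$ is the unique minimizer of $\lVert u - w \rVert^2$ over all monotone vectors $u$ (i.e., $u_1 \leq \dots \leq u_m$) satisfying the lower-bound constraint $u_1 \geq c$. -/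
/-- Variational inequality for the minimizer of the squared distance to `w` over a convex set of
real-valued functions. -/
theorem sum_sub_mul_sub_nonneg_of_convex_of_min {ι : Type*} {s : Finset ι} {K : Set (ι → ℝ)}
    (hK : Convex ℝ K) {w p v : ι → ℝ} (hp : p ∈ K) (hv : v ∈ K)
    (hmin : ∀ u ∈ K, ∑ i ∈ s, (p i - w i) ^ 2 ≤ ∑ i ∈ s, (u i - w i) ^ 2) :
    0 ≤ ∑ i ∈ s, (p i - w i) * (v i - p i) := by
  set A := ∑ i ∈ s, (p i - w i) * (v i - p i) with hA
  set B := ∑ i ∈ s, (v i - p i) ^ 2 with hB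
  have hB0 : 0 ≤ B := Finset.sum_nonneg fun i _ => sq_nonneg _
  have key : ∀ t : ℝ, 0 < t → t ≤ 1 → 0 ≤ 2 * A + t * B := by
    intro t ht0 ht1
    have h := hmin _ (hK hp hv (sub_nonneg.2 ht1) ht0.le (sub_add_cancel 1 t))
    have hexp : ∑ i ∈ s, (((1 - t) • p + t • v) i - w i) ^ 2
        = ∑ i ∈ s, (p i - w i) ^ 2 + t * (2 * A + t * B) := by
      rw [hA, hB]
      simp only [Finset.mul_sum, ← Finset.sum_add_distrib]
      refine Finset.sum_congr rfl fun i _ => ?_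
      simp only [Pi.add_apply, Pi.smul_apply, smul_eq_mul]
      ring
    rw [hexp] at h
    exact nonneg_of_mul_nonneg_right (by linarith) ht0
  by_contra! hneg
  have hBA : 0 < B - A := by linarith
  have h := key (-A / (B - A)) (div_pos (by linarith) hBA) ((div_le_one hBA).2 (by linarith))
  have hlt : -A / (B - A) * B ≤ -A := by
    rw [div_mul_eq_mul_div, div_le_iff₀ hBA]
    nlinarith
  linarith

/-- Functions that are monotone on a set form a convex set. -/
theorem convex_setOf_monotoneOn {ι : Type*} [Preorder ι] (s : Set ι) :
    Convex ℝ {u : ι → ℝ | MonotoneOn u s} := by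
  intro u hu v hv a b ha hb _ j hj k hk hjk
  exact add_le_add (mul_le_mul_of_nonneg_left (hu hj hk hjk) ha)
    (mul_le_mul_of_nonneg_left (hv hj hk hjk) hb)

/-
STATEMENT 3: clipping the isotonic regression from below gives the unique minimizer
of the squared error over monotone vectors with a lower-bound constraint on the
first entry.  Vectors in ℝ^m are modeled as `ℕ → ℝ` with relevant indices 1..m.
-/
theorem stmt_3 (m : ℕ) (hm : 1 ≤ m) (w : ℕ → ℝ) (c : ℝ) (what : ℕ → ℝ)
    -- `what` is the isotonic regression of w:
    (hmono : ∀ j k : ℕ, 1 ≤ j → j ≤ k → k ≤ m → what j ≤ what k)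
    (hmin : ∀ u : ℕ → ℝ, (∀ j k : ℕ, 1 ≤ j → j ≤ k → k ≤ m → u j ≤ u k) →
      ∑ j ∈ Finset.Icc 1 m, (what j - w j) ^ 2 ≤ ∑ j ∈ Finset.Icc 1 m, (u j - w j) ^ 2)
    -- the clipped vector w*:
    (wstar : ℕ → ℝ) (hwstar : ∀ k : ℕ, wstar k = max (what k) c) :
    -- w* is feasible:
    ((∀ j k : ℕ, 1 ≤ j → j ≤ k → k ≤ m → wstar j ≤ wstar k) ∧ c ≤ wstar 1) ∧
    -- and w* is the unique minimizer among feasible vectors: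
    (∀ u : ℕ → ℝ, (∀ j k : ℕ, 1 ≤ j → j ≤ k → k ≤ m → u j ≤ u k) → c ≤ u 1 →
      (∑ k ∈ Finset.Icc 1 m, (wstar k - w k) ^ 2 ≤ ∑ k ∈ Finset.Icc 1 m, (u k - w k) ^ 2) ∧
      ((∃ k ∈ Finset.Icc 1 m, u k ≠ wstar k) →
        ∑ k ∈ Finset.Icc 1 m, (wstar k - w k) ^ 2 < ∑ k ∈ Finset.Icc 1 m, (u k - w k) ^ 2)) := by
  have hmonoOn : ∀ u : ℕ → ℝ, MonotoneOn u (Set.Icc 1 m) ↔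
      ∀ j k : ℕ, 1 ≤ j → j ≤ k → k ≤ m → u j ≤ u k := fun u =>
    ⟨fun h j k hj hjk hk => h ⟨hj, hjk.trans hk⟩ ⟨hj.trans hjk, hk⟩ hjk,
      fun h j hj k hk hjk => h j k hj.1 hjk hk.2⟩
  refine ⟨⟨fun j k hj hjk hk => ?_, ?_⟩, fun u hu hcu => ?_⟩
  · rw [hwstar, hwstar]
    exact max_le_max_right c (hmono j k hj hjk hk)
  · rw [hwstar]
    exact le_max_right _ _
  have hvar : 0 ≤ ∑ k ∈ Finset.Icc 1 m,
      (what k - w k) * (u k + min (what k) c - c - what k) := by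
    refine sum_sub_mul_sub_nonneg_of_convex_of_min (convex_setOf_monotoneOn (Set.Icc 1 m))
      (v := fun k => u k + min (what k) c - c) ((hmonoOn _).2 hmono) ((hmonoOn _).2 ?_)
      fun v hv => hmin v ((hmonoOn v).1 hv)
    intro j k hj hjk hk
    have h := min_le_min_right c (hmono j k hj hjk hk)
    linarith [hu j k hj hjk hk]
  have hpyth : ∑ k ∈ Finset.Icc 1 m, (wstar k - w k) ^ 2
      + ∑ k ∈ Finset.Icc 1 m, (u k - wstar k) ^ 2
      ≤ ∑ k ∈ Finset.Icc 1 m, (u k - w k) ^ 2 := by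
    have hle : ∑ k ∈ Finset.Icc 1 m, ((wstar k - w k) ^ 2 + (u k - wstar k) ^ 2
        + 2 * ((what k - w k) * (u k + min (what k) c - c - what k)))
        ≤ ∑ k ∈ Finset.Icc 1 m, (u k - w k) ^ 2 := by
      refine Finset.sum_le_sum fun k hk => ?_
      obtain ⟨hk1, hkm⟩ := Finset.mem_Icc.1 hk
      have hck : c ≤ u k := hcu.trans (hu 1 k le_rfl hk1 hkm)
      rw [hwstar]
      rcases le_total (what k) c with h | h
      · rw [max_eq_right h, min_eq_left h]
        nlinarith [mul_nonneg (sub_nonneg.2 h) (sub_nonneg.2 hck)]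
      · rw [max_eq_left h, min_eq_right h]
        exact le_of_eq (by ring)
    rw [Finset.sum_add_distrib, Finset.sum_add_distrib, ← Finset.mul_sum] at hle
    linarith
  refine ⟨?_, ?_⟩
  · linarith [Finset.sum_nonneg fun k (_ : k ∈ Finset.Icc 1 m) => sq_nonneg (u k - wstar k)]
  · rintro ⟨k, hk, hne⟩
    have hpos : 0 < ∑ k ∈ Finset.Icc 1 m, (u k - wstar k) ^ 2 :=
      Finset.sum_pos' (fun i _ => sq_nonneg _) ⟨k, hk, sq_pos_of_ne_zero (sub_ne_zero.2 hne)⟩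
    linarith
end

section
/- Let $K \geq 1$, let $v^1 \in \mathbb{R}^{d_1}, \dots, v^K \in \mathbb{R}^{d_K}$, and fix indices $i_k \in \{1,\dots,d_k\}$ for each $k$. Define $g : \mathbb{R} \to \mathbb{R}$ by $g(c) = \min \{ \sum_{k=1}^K \lVert \hat{v}^k - v^k \rVert^2 : \hat{v}^k_1 \leq \dots \leq \hat{v}^k_{d_k} \text{ and } \hat{v}^k_{i_k} = c \text{ for all } k \}$. Then $g$ is differentiable at every point of $\mathbb{R}$. -/
open Filter Topology in
/-- A midpoint-convex function that is locally bounded above by a quadratic touching it at `c` is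
differentiable at `c`. -/
theorem hasDerivAt_of_midpoint_le_of_le_quadratic {g : ℝ → ℝ} {c A B : ℝ}
    (hmid : ∀ t, 2 * g c ≤ g (c + t) + g (c - t))
    (hup : ∀ᶠ t in 𝓝 (0 : ℝ), g (c + t) ≤ g c + t * A + t ^ 2 * B) :
    HasDerivAt g A c := by
  rw [hasDerivAt_iff_isLittleO_nhds_zero]
  have hneg : Tendsto (fun t : ℝ => -t) (𝓝 0) (𝓝 0) := by
    simpa using (continuous_neg (G := ℝ)).tendsto 0
  have hO : (fun t => g (c + t) - g c - t • A) =O[𝓝 0] fun t : ℝ => t ^ 2 := by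
    refine Asymptotics.IsBigO.of_bound B ?_
    filter_upwards [hup, hneg.eventually hup] with t h1 h2
    have h3 := hmid t
    rw [← sub_eq_add_neg] at h2
    rw [Real.norm_eq_abs, Real.norm_eq_abs, abs_of_nonneg (sq_nonneg t), abs_le, smul_eq_mul]
    constructor <;> linarith [neg_sq t]
  exact hO.trans_isLittleO (Asymptotics.isLittleO_pow_id one_lt_two)

open Filter Topology in
/-- Shifting a whole level set of a finite sequence by a small amount preserves monotonicity. -/
theorem eventually_add_ite_le_add_ite {n : ℕ} {u : ℕ → ℝ} (c : ℝ)
    (hu : ∀ a b : ℕ, 1 ≤ a → a ≤ b → b ≤ n → u a ≤ u b) :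
    ∀ᶠ t in 𝓝 (0 : ℝ), ∀ a b : ℕ, 1 ≤ a → a ≤ b → b ≤ n →
      u a + t * (if u a = c then 1 else 0) ≤ u b + t * (if u b = c then 1 else 0) := by
  have key : ∀ᶠ t in 𝓝 (0 : ℝ), ∀ a ∈ Finset.Icc 1 n, ∀ b ∈ Finset.Icc 1 n, a ≤ b →
      u a + t * (if u a = c then 1 else 0) ≤ u b + t * (if u b = c then 1 else 0) := by
    simp only [eventually_all_finset, eventually_imp_distrib_left]
    intro a ha b hb hab
    rw [Finset.mem_Icc] at ha hb
    rcases (hu a b ha.1 hab hb.2).eq_or_lt with h | h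
    · simp [h]
    · have hcont : ∀ x e : ℝ, Tendsto (fun t : ℝ => x + t * e) (𝓝 0) (𝓝 x) := fun x e => by
        have : Continuous fun t : ℝ => x + t * e := by fun_prop
        simpa using this.tendsto 0
      exact ((hcont _ _).eventually_lt (hcont _ _) h).mono fun t ht => ht.le
  filter_upwards [key] with t ht a b ha hab hb
  exact ht a (Finset.mem_Icc.2 ⟨ha, hab.trans hb⟩) b (Finset.mem_Icc.2 ⟨ha.trans hab, hb⟩) hab

/-
STATEMENT 5: differentiability of the IISO value function g.
Setup as in Statement 4: vectors `v k` (k < K) have relevant indices 1..(d k) with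
pivot `idx k`, and `g c` is the attained minimum of the squared-error objective over
feasible tuples whose common pivot value is c.
-/
theorem stmt_5 (K : ℕ) (hK : 1 ≤ K) (d : ℕ → ℕ) (v : ℕ → ℕ → ℝ) (idx : ℕ → ℕ)
    (hidx : ∀ k, k < K → 1 ≤ idx k ∧ idx k ≤ d k)
    (g : ℝ → ℝ)
    (hg : ∀ c : ℝ, IsLeast {s : ℝ | ∃ vhat : ℕ → ℕ → ℝ,
      (∀ k, k < K →
        (∀ a b : ℕ, 1 ≤ a → a ≤ b → b ≤ d k → vhat k a ≤ vhat k b) ∧ vhat k (idx k) = c) ∧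
      s = ∑ k ∈ Finset.range K, ∑ j ∈ Finset.Icc 1 (d k), (vhat k j - v k j) ^ 2} (g c)) :
    ∀ c : ℝ, DifferentiableAt ℝ g c := by
  intro c
  obtain ⟨w, hw, hgc⟩ := (hg c).1
  let e : ℕ → ℕ → ℝ := fun k j => if w k j = c then 1 else 0
  refine (hasDerivAt_of_midpoint_le_of_le_quadratic
    (A := ∑ k ∈ Finset.range K, ∑ j ∈ Finset.Icc 1 (d k), 2 * e k j * (w k j - v k j))
    (B := ∑ k ∈ Finset.range K, ∑ j ∈ Finset.Icc 1 (d k), e k j ^ 2) ?_ ?_).differentiableAt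
  · intro t
    obtain ⟨x, hx, hgx⟩ := (hg (c + t)).1
    obtain ⟨y, hy, hgy⟩ := (hg (c - t)).1
    have hle := (hg c).2 ⟨fun k j => (x k j + y k j) / 2, fun k hk => ⟨fun a b ha hab hb => ?_, ?_⟩,
      rfl⟩
    · refine (mul_le_mul_of_nonneg_left hle zero_le_two).trans ?_
      rw [hgx, hgy]
      simp only [Finset.mul_sum, ← Finset.sum_add_distrib]
      refine Finset.sum_le_sum fun k _ => Finset.sum_le_sum fun j _ => ?_
      nlinarith [sq_nonneg (x k j - y k j)]
    · have h1 := (hx k hk).1 a b ha hab hb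
      have h2 := (hy k hk).1 a b ha hab hb
      linarith
    · simp only [(hx k hk).2, (hy k hk).2]
      ring
  · have hmono : ∀ᶠ t in nhds (0 : ℝ), ∀ k ∈ Finset.range K, ∀ a b : ℕ, 1 ≤ a → a ≤ b → b ≤ d k →
        w k a + t * e k a ≤ w k b + t * e k b := by
      rw [Filter.eventually_all_finset]
      exact fun k hk => eventually_add_ite_le_add_ite c (hw k (Finset.mem_range.1 hk)).1
    filter_upwards [hmono] with t ht
    have hle := (hg (c + t)).2 ⟨fun k j => w k j + t * e k j,
      fun k hk => ⟨ht k (Finset.mem_range.2 hk), by simp [e, (hw k hk).2]⟩, rfl⟩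
    refine hle.trans_eq ?_
    rw [hgc]
    simp only [Finset.mul_sum, ← Finset.sum_add_distrib]
    refine Finset.sum_congr rfl fun k _ => Finset.sum_congr rfl fun j _ => ?_
    ring
end

section
/- Let $K \geq 1$, let $v^1 \in \mathbb{R}^{d_1}, \dots, v^K \in \mathbb{R}^{d_K}$, and fix indices $i_k \in \{1,\dots,d_k\}$. For each $k$, let $\ell^k = (v^k_1,\dots,v^k_{i_k-1})$ and $r^k = (v^k_{i_k+1},\dots,v^k_{d_k})$ be the tails of $v^k$ about the pivot $i_k$, with isotonic regressions $\hat{\ell}^k, \hat{r}^k$. Then for every $c \in \mathbb{R}$, the value function $g(c) = \min \{ \sum_{k=1}^K \lVert \hat{v}^k - v^k \rVert^2 : \hat{v}^k \text{ monotone nondecreasing}, \hat{v}^k_{i_k} = c \}$ satisfies $g(c) = \sum_{k=1}^K (c - v^k_{i_k})^2 + \sum_{k=1}^K \sum_{i=1}^{i_k - 1} (\ell^k_i - \min(\hat{\ell}^k_i, c))^2 + \sum_{k=1}^K \sum_{j=1}^{d_k - i_k} (r^k_j - \max(\hat{r}^k_j, c))^2$. -/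
/-- Clipping the isotonic regression from above at `c` is optimal among monotone vectors
bounded above by `c`. -/
lemma sum_sq_min_isotonic_le {p q : ℕ} {v h u : ℕ → ℝ} {c : ℝ}
    (hmono : ∀ a b : ℕ, p ≤ a → a ≤ b → b ≤ q → h a ≤ h b)
    (hmin : ∀ w : ℕ → ℝ, (∀ a b : ℕ, p ≤ a → a ≤ b → b ≤ q → w a ≤ w b) →
      ∑ j ∈ Finset.Icc p q, (h j - v j) ^ 2 ≤ ∑ j ∈ Finset.Icc p q, (w j - v j) ^ 2)
    (hu : ∀ a b : ℕ, p ≤ a → a ≤ b → b ≤ q → u a ≤ u b)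
    (huc : ∀ a, p ≤ a → a ≤ q → u a ≤ c) :
    ∑ j ∈ Finset.Icc p q, (v j - min (h j) c) ^ 2 ≤
      ∑ j ∈ Finset.Icc p q, (u j - v j) ^ 2 := by
  have key := hmin (fun j => u j + (h j - min (h j) c)) (by
    intro a b ha hab hb
    have h1 := hmono a b ha hab hb
    have h2 := hu a b ha hab hb
    rcases min_cases (h a) c with h3 | h3 <;> rcases min_cases (h b) c with h4 | h4 <;> linarith)
  have pw : ∑ j ∈ Finset.Icc p q,
      ((v j - min (h j) c) ^ 2 + (u j + (h j - min (h j) c) - v j) ^ 2) ≤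
      ∑ j ∈ Finset.Icc p q, ((u j - v j) ^ 2 + (h j - v j) ^ 2) := by
    refine Finset.sum_le_sum fun j hj => ?_
    obtain ⟨hp, hq⟩ := Finset.mem_Icc.mp hj
    have h1 := huc j hp hq
    rcases min_cases (h j) c with ⟨h3, h4⟩ | ⟨h3, h4⟩ <;> rw [h3]
    · nlinarith
    · nlinarith [mul_nonneg (sub_nonneg.2 h1) (sub_nonneg.2 h4.le)]
  rw [Finset.sum_add_distrib, Finset.sum_add_distrib] at pw
  linarith

/-- Clipping the isotonic regression from below at `c` is optimal among monotone vectors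
bounded below by `c`. -/
lemma sum_sq_max_isotonic_le {p q : ℕ} {v h u : ℕ → ℝ} {c : ℝ}
    (hmono : ∀ a b : ℕ, p ≤ a → a ≤ b → b ≤ q → h a ≤ h b)
    (hmin : ∀ w : ℕ → ℝ, (∀ a b : ℕ, p ≤ a → a ≤ b → b ≤ q → w a ≤ w b) →
      ∑ j ∈ Finset.Icc p q, (h j - v j) ^ 2 ≤ ∑ j ∈ Finset.Icc p q, (w j - v j) ^ 2)
    (hu : ∀ a b : ℕ, p ≤ a → a ≤ b → b ≤ q → u a ≤ u b)
    (huc : ∀ a, p ≤ a → a ≤ q → c ≤ u a) :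
    ∑ j ∈ Finset.Icc p q, (v j - max (h j) c) ^ 2 ≤
      ∑ j ∈ Finset.Icc p q, (u j - v j) ^ 2 := by
  have key := hmin (fun j => u j + (h j - max (h j) c)) (by
    intro a b ha hab hb
    have h1 := hmono a b ha hab hb
    have h2 := hu a b ha hab hb
    rcases max_cases (h a) c with h3 | h3 <;> rcases max_cases (h b) c with h4 | h4 <;> linarith)
  have pw : ∑ j ∈ Finset.Icc p q,
      ((v j - max (h j) c) ^ 2 + (u j + (h j - max (h j) c) - v j) ^ 2) ≤
      ∑ j ∈ Finset.Icc p q, ((u j - v j) ^ 2 + (h j - v j) ^ 2) := by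
    refine Finset.sum_le_sum fun j hj => ?_
    obtain ⟨hp, hq⟩ := Finset.mem_Icc.mp hj
    have h1 := huc j hp hq
    rcases max_cases (h j) c with ⟨h3, h4⟩ | ⟨h3, h4⟩ <;> rw [h3]
    · nlinarith
    · nlinarith [mul_nonneg (sub_nonneg.2 h1) (sub_nonneg.2 h4.le)]
  rw [Finset.sum_add_distrib, Finset.sum_add_distrib] at pw
  linarith

lemma sum_Icc_split_pivot {i d : ℕ} (hi : 1 ≤ i) (hid : i ≤ d) (f : ℕ → ℝ) :
    ∑ j ∈ Finset.Icc 1 d, f j =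
      f i + ∑ j ∈ Finset.Icc 1 (i - 1), f j + ∑ j ∈ Finset.Icc (i + 1) d, f j := by
  have hs : Finset.Icc 1 d =
      insert i (Finset.Icc 1 (i - 1) ∪ Finset.Icc (i + 1) d) := by
    ext x
    simp only [Finset.mem_Icc, Finset.mem_insert, Finset.mem_union]
    omega
  rw [hs, Finset.sum_insert, Finset.sum_union, add_assoc]
  · rw [Finset.disjoint_left]
    intro x
    simp only [Finset.mem_Icc]
    omega
  · simp only [Finset.mem_Icc, Finset.mem_union]
    omega

/-
STATEMENT 6: closed-form expression for the IISO value function g in terms of the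
isotonic regressions of the tails.  Vector k (k < K) has relevant indices 1..(d k)
with pivot `idx k`; its left tail consists of entries 1..(idx k - 1) and its right
tail of entries (idx k + 1)..(d k).  `lhat k` and `rhat k` are the isotonic
regressions of these tails (kept at the original indices).
-/
theorem stmt_6 (K : ℕ) (hK : 1 ≤ K) (d : ℕ → ℕ) (v : ℕ → ℕ → ℝ) (idx : ℕ → ℕ)
    (hidx : ∀ k, k < K → 1 ≤ idx k ∧ idx k ≤ d k)
    (lhat rhat : ℕ → ℕ → ℝ)
    -- `lhat k` is the isotonic regression of the left tail of v k:
    (hlmono : ∀ k, k < K → ∀ a b : ℕ, 1 ≤ a → a ≤ b → b ≤ idx k - 1 → lhat k a ≤ lhat k b)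
    (hlmin : ∀ k, k < K → ∀ u : ℕ → ℝ,
      (∀ a b : ℕ, 1 ≤ a → a ≤ b → b ≤ idx k - 1 → u a ≤ u b) →
      ∑ j ∈ Finset.Icc 1 (idx k - 1), (lhat k j - v k j) ^ 2 ≤
        ∑ j ∈ Finset.Icc 1 (idx k - 1), (u j - v k j) ^ 2)
    -- `rhat k` is the isotonic regression of the right tail of v k:
    (hrmono : ∀ k, k < K → ∀ a b : ℕ, idx k + 1 ≤ a → a ≤ b → b ≤ d k → rhat k a ≤ rhat k b)
    (hrmin : ∀ k, k < K → ∀ u : ℕ → ℝ,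
      (∀ a b : ℕ, idx k + 1 ≤ a → a ≤ b → b ≤ d k → u a ≤ u b) →
      ∑ j ∈ Finset.Icc (idx k + 1) (d k), (rhat k j - v k j) ^ 2 ≤
        ∑ j ∈ Finset.Icc (idx k + 1) (d k), (u j - v k j) ^ 2)
    -- g is the (attained) optimal value of the c-constrained IISO problem:
    (g : ℝ → ℝ)
    (hg : ∀ c : ℝ, IsLeast {s : ℝ | ∃ vhat : ℕ → ℕ → ℝ,
      (∀ k, k < K →
        (∀ a b : ℕ, 1 ≤ a → a ≤ b → b ≤ d k → vhat k a ≤ vhat k b) ∧ vhat k (idx k) = c) ∧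
      s = ∑ k ∈ Finset.range K, ∑ j ∈ Finset.Icc 1 (d k), (vhat k j - v k j) ^ 2} (g c)) :
    ∀ c : ℝ,
      g c = ∑ k ∈ Finset.range K, (c - v k (idx k)) ^ 2 +
        ∑ k ∈ Finset.range K, ∑ j ∈ Finset.Icc 1 (idx k - 1),
          (v k j - min (lhat k j) c) ^ 2 +
        ∑ k ∈ Finset.range K, ∑ j ∈ Finset.Icc (idx k + 1) (d k),
          (v k j - max (rhat k j) c) ^ 2 := by
  intro c
  rw [← Finset.sum_add_distrib, ← Finset.sum_add_distrib]
  refine (hg c).unique ⟨⟨fun k j => if j < idx k then min (lhat k j) c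
      else if j = idx k then c else max (rhat k j) c, ?_, ?_⟩, ?_⟩
  · intro k hk
    refine ⟨fun a b ha hab hb => ?_, by simp⟩
    dsimp only
    split_ifs
    any_goals omega
    · exact min_le_min_right c (hlmono k hk a b ha hab (by omega))
    · exact min_le_right _ _
    · exact (min_le_right _ _).trans (le_max_right _ _)
    · exact le_rfl
    · exact le_max_right _ _
    · exact max_le_max_right c (hrmono k hk a b (by omega) hab hb)
  · refine Finset.sum_congr rfl fun k hk => ?_
    obtain ⟨h1, h2⟩ := hidx k (Finset.mem_range.mp hk)
    rw [sum_Icc_split_pivot h1 h2]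
    congr 1
    · congr 1
      · simp
      · refine Finset.sum_congr rfl fun j hj => ?_
        rw [Finset.mem_Icc] at hj
        dsimp only
        rw [if_pos (by omega)]
        ring
    · refine Finset.sum_congr rfl fun j hj => ?_
      rw [Finset.mem_Icc] at hj
      dsimp only
      rw [if_neg (by omega), if_neg (by omega)]
      ring
  · rintro s ⟨u, hu, rfl⟩
    refine Finset.sum_le_sum fun k hk => ?_
    rw [Finset.mem_range] at hk
    obtain ⟨h1, h2⟩ := hidx k hk
    obtain ⟨humono, huc⟩ := hu k hk
    rw [sum_Icc_split_pivot h1 h2, huc]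
    refine add_le_add (add_le_add le_rfl ?_) ?_
    · refine sum_sq_min_isotonic_le (hlmono k hk) (hlmin k hk)
        (fun a b ha hab hb => humono a b ha hab (by omega)) fun a ha hb => ?_
      rw [← huc]
      exact humono a _ ha (by omega) h2
    · refine sum_sq_max_isotonic_le (hrmono k hk) (hrmin k hk)
        (fun a b ha hab hb => humono a b (by omega) hab hb) fun a ha hb => ?_
      rw [← huc]
      exact humono _ a h1 (by omega) hb
end

section
/- Let $K \geq 1$, let $v^1 \in \mathbb{R}^{d_1}, \dots, v^K \in \mathbb{R}^{d_K}$, and fix indices $i_k \in \{1,\dots,d_k\}$. For each $k$, let $\hat{\ell}^k$ and $\hat{r}^k$ be the isotonic regressions of the left and right tails of $v^k$ about the pivot $i_k$. Let $T \subset \mathbb{R}$ be the finite set of all entries of all vectors $\hat{\ell}^1,\dots,\hat{\ell}^K,\hat{r}^1,\dots,\hat{r}^K$. Then on each interval of $\mathbb{R}$ whose interior contains no point of $T$ (i.e., on each of the intervals determined by consecutive elements of $T$, and on the two unbounded intervals beyond $\min T$ and $\max T$), the value function $g(c) = \min \{ \sum_{k=1}^K \lVert \hat{v}^k - v^k \rVert^2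 : \hat{v}^k \text{ monotone nondecreasing}, \hat{v}^k_{i_k} = c \}$ coincides with a polynomial in $c$ of degree at most $2$. -/
/-- If `l` is the isotonic regression of `v` on `s`, then capping `l` at `c` gives the best
monotone fit of `v` on `s` bounded above by `c`. -/
theorem sum_sq_min_le_of_isotonic (s : Finset ℕ) (l v u : ℕ → ℝ) (c : ℝ)
    (hl : MonotoneOn l s)
    (hmin : ∀ w : ℕ → ℝ, MonotoneOn w s →
      ∑ j ∈ s, (l j - v j) ^ 2 ≤ ∑ j ∈ s, (w j - v j) ^ 2)
    (hu : MonotoneOn u s) (huc : ∀ j ∈ s, u j ≤ c) :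
    ∑ j ∈ s, (min (l j) c - v j) ^ 2 ≤ ∑ j ∈ s, (u j - v j) ^ 2 := by
  have h := hmin (fun j => u j + (max (l j) c - c)) (fun a ha b hb hab => by
    have h₁ := hu ha hb hab
    have h₂ := max_le_max_right c (hl ha hb hab)
    dsimp only
    linarith)
  have hpt : ∑ j ∈ s, ((u j + (max (l j) c - c) - v j) ^ 2 - (l j - v j) ^ 2) ≤
      ∑ j ∈ s, ((u j - v j) ^ 2 - (min (l j) c - v j) ^ 2) := by
    refine Finset.sum_le_sum fun j hj => ?_
    have := huc j hj
    rcases le_total (l j) c with hc | hc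
    · simp [hc]
    · rw [max_eq_left hc, min_eq_right hc]
      nlinarith [mul_nonneg (sub_nonneg.2 hc) (sub_nonneg.2 this)]
  simp only [Finset.sum_sub_distrib] at hpt
  linarith

/-- If `r` is the isotonic regression of `v` on `s`, then raising `r` to at least `c` gives the
best monotone fit of `v` on `s` bounded below by `c`. -/
theorem sum_sq_max_le_of_isotonic (s : Finset ℕ) (r v u : ℕ → ℝ) (c : ℝ)
    (hr : MonotoneOn r s)
    (hmin : ∀ w : ℕ → ℝ, MonotoneOn w s →
      ∑ j ∈ s, (r j - v j) ^ 2 ≤ ∑ j ∈ s, (w j - v j) ^ 2)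
    (hu : MonotoneOn u s) (huc : ∀ j ∈ s, c ≤ u j) :
    ∑ j ∈ s, (max (r j) c - v j) ^ 2 ≤ ∑ j ∈ s, (u j - v j) ^ 2 := by
  have h := hmin (fun j => u j + (min (r j) c - c)) (fun a ha b hb hab => by
    have h₁ := hu ha hb hab
    have h₂ := min_le_min_right c (hr ha hb hab)
    dsimp only
    linarith)
  have hpt : ∑ j ∈ s, ((u j + (min (r j) c - c) - v j) ^ 2 - (r j - v j) ^ 2) ≤
      ∑ j ∈ s, ((u j - v j) ^ 2 - (max (r j) c - v j) ^ 2) := by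
    refine Finset.sum_le_sum fun j hj => ?_
    have := huc j hj
    rcases le_total (r j) c with hc | hc
    · rw [max_eq_right hc, min_eq_left hc]
      nlinarith [mul_nonneg (sub_nonneg.2 hc) (sub_nonneg.2 this)]
    · simp [hc]
  simp only [Finset.sum_sub_distrib] at hpt
  linarith

theorem sum_Icc_eq_left_add_pivot_add_right {i n : ℕ} (hi : 1 ≤ i) (hin : i ≤ n) (f : ℕ → ℝ) :
    ∑ j ∈ Finset.Icc 1 n, f j =
      ∑ j ∈ Finset.Icc 1 (i - 1), f j + f i + ∑ j ∈ Finset.Icc (i + 1) n, f j := by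
  have hsplit : Finset.Icc 1 n =
      (insert i (Finset.Icc 1 (i - 1))) ∪ Finset.Icc (i + 1) n := by
    ext j
    simp only [Finset.mem_union, Finset.mem_insert, Finset.mem_Icc]
    omega
  rw [hsplit, Finset.sum_union, Finset.sum_insert]
  · ring
  · simp only [Finset.mem_Icc]
    omega
  · rw [Finset.disjoint_left]
    simp only [Finset.mem_insert, Finset.mem_Icc]
    omega

theorem Set.OrdConnected.forall_le_or_forall_ge_of_notMem_interior {S : Set ℝ}
    (hS : S.OrdConnected) {t : ℝ} (ht : t ∉ interior S) :
    (∀ c ∈ S, c ≤ t) ∨ (∀ c ∈ S, t ≤ c) := by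
  by_contra! h
  obtain ⟨⟨b, hb, htb⟩, a, ha, hat⟩ := h
  exact ht (mem_interior.2 ⟨Set.Ioo a b, Set.Ioo_subset_Icc_self.trans (hS.out ha hb),
    isOpen_Ioo, hat, htb⟩)

/-- `f` coincides on `S` with a polynomial of degree at most two. -/
def QuadraticOn (f : ℝ → ℝ) (S : Set ℝ) : Prop :=
  ∃ p : Polynomial ℝ, p.degree ≤ 2 ∧ ∀ c ∈ S, f c = p.eval c

namespace QuadraticOn

variable {S : Set ℝ} {f h : ℝ → ℝ}

theorem congr (hf : QuadraticOn f S) (hfh : ∀ c ∈ S, h c = f c) : QuadraticOn h S := by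
  obtain ⟨p, hp, hpf⟩ := hf
  exact ⟨p, hp, fun c hc => (hfh c hc).trans (hpf c hc)⟩

theorem const (a : ℝ) : QuadraticOn (fun _ => a) S :=
  ⟨Polynomial.C a, Polynomial.degree_C_le.trans (by norm_num), fun c _ => by simp⟩

theorem sq_sub_const (a : ℝ) : QuadraticOn (fun c => (c - a) ^ 2) S :=
  ⟨(Polynomial.X - Polynomial.C a) ^ 2, by simp [Polynomial.degree_pow],
    fun c _ => by simp⟩

theorem add (hf : QuadraticOn f S) (hh : QuadraticOn h S) :
    QuadraticOn (fun c => f c + h c) S := by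
  obtain ⟨p, hp, hpf⟩ := hf
  obtain ⟨q, hq, hqh⟩ := hh
  exact ⟨p + q, (Polynomial.degree_add_le p q).trans (max_le hp hq),
    fun c hc => by simp [hpf c hc, hqh c hc]⟩

theorem sum {s : Finset ℕ} {F : ℕ → ℝ → ℝ} (hF : ∀ j ∈ s, QuadraticOn (F j) S) :
    QuadraticOn (fun c => ∑ j ∈ s, F j c) S := by
  induction s using Finset.induction_on with
  | empty => simpa using const (S := S) 0
  | insert i s hi ih =>
    simp only [Finset.sum_insert hi]
    exact (hF i (by simp)).add (ih fun j hj => hF j (by simp [hj]))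

theorem sq_min_sub (hS : S.OrdConnected) {t : ℝ} (ht : t ∉ interior S) (a : ℝ) :
    QuadraticOn (fun c => (min t c - a) ^ 2) S := by
  rcases hS.forall_le_or_forall_ge_of_notMem_interior ht with h | h
  · exact (sq_sub_const a).congr fun c hc => by rw [min_eq_right (h c hc)]
  · exact (const ((t - a) ^ 2)).congr fun c hc => by rw [min_eq_left (h c hc)]

theorem sq_max_sub (hS : S.OrdConnected) {t : ℝ} (ht : t ∉ interior S) (a : ℝ) :
    QuadraticOn (fun c => (max t c - a) ^ 2) S := by
  rcases hS.forall_le_or_forall_ge_of_notMem_interior ht with h | h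
  · exact (const ((t - a) ^ 2)).congr fun c hc => by rw [max_eq_left (h c hc)]
  · exact (sq_sub_const a).congr fun c hc => by rw [max_eq_right (h c hc)]

end QuadraticOn


/-
STATEMENT 7: the IISO value function g is piecewise quadratic with knots at the
entries of the isotonic regressions of the tails.  T is the (finite) set of all
entries of the fitted tails; on every interval (order-connected set) whose interior
contains no point of T, g coincides with a polynomial of degree at most 2.
-/
theorem stmt_7 (K : ℕ) (hK : 1 ≤ K) (d : ℕ → ℕ) (v : ℕ → ℕ → ℝ) (idx : ℕ → ℕ)
    (hidx : ∀ k, k < K → 1 ≤ idx k ∧ idx k ≤ d k)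
    (lhat rhat : ℕ → ℕ → ℝ)
    -- `lhat k` is the isotonic regression of the left tail of v k:
    (hlmono : ∀ k, k < K → ∀ a b : ℕ, 1 ≤ a → a ≤ b → b ≤ idx k - 1 → lhat k a ≤ lhat k b)
    (hlmin : ∀ k, k < K → ∀ u : ℕ → ℝ,
      (∀ a b : ℕ, 1 ≤ a → a ≤ b → b ≤ idx k - 1 → u a ≤ u b) →
      ∑ j ∈ Finset.Icc 1 (idx k - 1), (lhat k j - v k j) ^ 2 ≤
        ∑ j ∈ Finset.Icc 1 (idx k - 1), (u j - v k j) ^ 2)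
    -- `rhat k` is the isotonic regression of the right tail of v k:
    (hrmono : ∀ k, k < K → ∀ a b : ℕ, idx k + 1 ≤ a → a ≤ b → b ≤ d k → rhat k a ≤ rhat k b)
    (hrmin : ∀ k, k < K → ∀ u : ℕ → ℝ,
      (∀ a b : ℕ, idx k + 1 ≤ a → a ≤ b → b ≤ d k → u a ≤ u b) →
      ∑ j ∈ Finset.Icc (idx k + 1) (d k), (rhat k j - v k j) ^ 2 ≤
        ∑ j ∈ Finset.Icc (idx k + 1) (d k), (u j - v k j) ^ 2)
    -- g is the (attained) optimal value of the c-constrained IISO problem: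
    (g : ℝ → ℝ)
    (hg : ∀ c : ℝ, IsLeast {s : ℝ | ∃ vhat : ℕ → ℕ → ℝ,
      (∀ k, k < K →
        (∀ a b : ℕ, 1 ≤ a → a ≤ b → b ≤ d k → vhat k a ≤ vhat k b) ∧ vhat k (idx k) = c) ∧
      s = ∑ k ∈ Finset.range K, ∑ j ∈ Finset.Icc 1 (d k), (vhat k j - v k j) ^ 2} (g c))
    -- T is the set of all entries of the fitted tails:
    (T : Set ℝ)
    (hT : T = {t : ℝ | ∃ k, k < K ∧
      ((∃ j, 1 ≤ j ∧ j ≤ idx k - 1 ∧ lhat k j = t) ∨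
       (∃ j, idx k + 1 ≤ j ∧ j ≤ d k ∧ rhat k j = t))}) :
    ∀ S : Set ℝ, S.OrdConnected → (∀ t ∈ T, t ∉ interior S) →
      ∃ p : Polynomial ℝ, p.degree ≤ 2 ∧ ∀ c ∈ S, g c = p.eval c := by
  intro S hS hTS
  have monotoneOn_Icc : ∀ {m n : ℕ} {w : ℕ → ℝ},
      MonotoneOn w (Finset.Icc m n) ↔ ∀ a b : ℕ, m ≤ a → a ≤ b → b ≤ n → w a ≤ w b := by
    intro m n w
    simp only [MonotoneOn, Finset.coe_Icc, Set.mem_Icc]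
    exact ⟨fun h a b ha hab hb => h ⟨ha, hab.trans hb⟩ ⟨ha.trans hab, hb⟩ hab,
      fun h a ha b hb hab => h a b ha.1 hab hb.2⟩
  have hgc : ∀ c, g c = ∑ k ∈ Finset.range K,
      (∑ j ∈ Finset.Icc 1 (idx k - 1), (min (lhat k j) c - v k j) ^ 2 + (c - v k (idx k)) ^ 2 +
        ∑ j ∈ Finset.Icc (idx k + 1) (d k), (max (rhat k j) c - v k j) ^ 2) := by
    intro c
    refine (hg c).unique ⟨⟨fun k j => if j < idx k then min (lhat k j) c else
      if j = idx k then c else max (rhat k j) c, fun k hk => ⟨fun a b ha hab hb => ?_, by simp⟩,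
      Finset.sum_congr rfl fun k hk => ?_⟩, ?_⟩
    · dsimp only
      split_ifs <;> try omega
      · exact min_le_min_right c (hlmono k hk a b ha hab (by omega))
      · exact min_le_right _ _
      · exact (min_le_right _ _).trans (le_max_right _ _)
      · exact le_rfl
      · exact le_max_right _ _
      · exact max_le_max_right c (hrmono k hk a b (by omega) hab hb)
    · obtain ⟨h₁, h₂⟩ := hidx k (Finset.mem_range.1 hk)
      rw [sum_Icc_eq_left_add_pivot_add_right h₁ h₂]
      congr 1
      · congr 1
        · refine Finset.sum_congr rfl fun j hj => ?_
          rw [Finset.mem_Icc] at hj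
          dsimp only
          rw [if_pos (by omega)]
        · simp
      · refine Finset.sum_congr rfl fun j hj => ?_
        rw [Finset.mem_Icc] at hj
        dsimp only
        rw [if_neg (by omega), if_neg (by omega)]
    · rintro _ ⟨w, hw, rfl⟩
      refine Finset.sum_le_sum fun k hk => ?_
      have hk := Finset.mem_range.1 hk
      obtain ⟨h₁, h₂⟩ := hidx k hk
      obtain ⟨hmono, hpiv⟩ := hw k hk
      rw [sum_Icc_eq_left_add_pivot_add_right h₁ h₂, hpiv]
      refine add_le_add (add_le_add ?_ le_rfl) ?_
      · refine sum_sq_min_le_of_isotonic _ _ _ _ c (monotoneOn_Icc.2 (hlmono k hk))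
          (fun u hu => hlmin k hk u (monotoneOn_Icc.1 hu))
          (monotoneOn_Icc.2 fun a b ha hab hb => hmono a b ha hab (by omega)) fun j hj => ?_
        rw [Finset.mem_Icc] at hj
        exact hpiv ▸ hmono j (idx k) hj.1 (by omega) h₂
      · refine sum_sq_max_le_of_isotonic _ _ _ _ c (monotoneOn_Icc.2 (hrmono k hk))
          (fun u hu => hrmin k hk u (monotoneOn_Icc.1 hu))
          (monotoneOn_Icc.2 fun a b ha hab hb => hmono a b (by omega) hab hb) fun j hj => ?_
        rw [Finset.mem_Icc] at hj
        exact hpiv ▸ hmono (idx k) j h₁ (by omega) hj.2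
  refine QuadraticOn.congr (QuadraticOn.sum fun k hk => ?_) fun c _ => hgc c
  have hk := Finset.mem_range.1 hk
  refine ((QuadraticOn.sum fun j hj => ?_).add (.sq_sub_const _)).add
    (QuadraticOn.sum fun j hj => ?_)
  · rw [Finset.mem_Icc] at hj
    exact .sq_min_sub hS (hTS _ (hT ▸ ⟨k, hk, .inl ⟨j, hj.1, hj.2, rfl⟩⟩)) _
  · rw [Finset.mem_Icc] at hj
    exact .sq_max_sub hS (hTS _ (hT ▸ ⟨k, hk, .inr ⟨j, hj.1, hj.2, rfl⟩⟩)) _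
end

section
/- Let $n_1, n_2 \geq 1$, $\ell \in \mathbb{R}^{n_1}$, and $r \in \mathbb{R}^{n_2}$. Consider the max-min problem: minimize $\sum_{i=1}^{n_1} (\ell_i - \tilde{\ell}_i)^2 + \sum_{j=1}^{n_2} (r_j - \tilde{r}_j)^2$ over $(\tilde{\ell}, \tilde{r}) \in \mathbb{R}^{n_1} \times \mathbb{R}^{n_2}$ subject to $\max_{1 \leq i \leq n_1} \tilde{\ell}_i \leq \min_{1 \leq j \leq n_2} \tilde{r}_j$. Then there exists $c \in \mathbb{R}$ such that the pair defined by $\tilde{\ell}_i = \min(c, \ell_i)$ for all $i$ and $\tilde{r}_j = \max(c, r_j)$ for all $j$ is an optimal solution of this problem. -/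
/-- Moving an upper cap `d` of `t` into `[-M, M]` and clipping `x` there costs at most `t`. -/
theorem sq_sub_min_clamp_le {x t d M : ℝ} (hx : |x| ≤ M) (ht : t ≤ d) :
    (x - min (max (-M) (min M d)) x) ^ 2 ≤ (x - t) ^ 2 := by
  obtain ⟨hx1, hx2⟩ := abs_le.mp hx
  rcases le_total x (max (-M) (min M d)) with h | h
  · rw [min_eq_right h, sub_self, zero_pow two_ne_zero]
    exact sq_nonneg _
  · rw [min_eq_left h]
    rcases le_total M d with hd | hd
    · have : M ≤ max (-M) (min M d) := by rw [min_eq_left hd]; exact le_max_right _ _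
      have hz : x - max (-M) (min M d) = 0 := by linarith
      rw [hz, zero_pow two_ne_zero]
      exact sq_nonneg _
    · have : d ≤ max (-M) (min M d) := by rw [min_eq_right hd]; exact le_max_right _ _
      exact pow_le_pow_left₀ (by linarith) (by linarith) 2

/-- Moving a lower cap `d` of `t` into `[-M, M]` and clipping `x` there costs at most `t`. -/
theorem sq_sub_max_clamp_le {x t d M : ℝ} (hx : |x| ≤ M) (ht : d ≤ t) :
    (x - max (max (-M) (min M d)) x) ^ 2 ≤ (x - t) ^ 2 := by
  obtain ⟨hx1, hx2⟩ := abs_le.mp hx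
  rcases le_total (max (-M) (min M d)) x with h | h
  · rw [max_eq_right h, sub_self, zero_pow two_ne_zero]
    exact sq_nonneg _
  · rw [max_eq_left h]
    rcases le_total (-M) (min M d) with hd | hd
    · rw [max_eq_right hd] at h ⊢
      have := min_le_right M d
      rw [← neg_sq, ← neg_sq (x - t)]
      exact pow_le_pow_left₀ (by linarith) (by linarith) 2
    · rw [max_eq_left hd] at h ⊢
      have hz : x - -M = 0 := by linarith
      rw [hz, zero_pow two_ne_zero]
      exact sq_nonneg _

/-
STATEMENT 9: the max-min tree-reshaping problem admits an optimal solution of the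
clipped form `lt i = min c (l i)`, `rt j = max c (r j)`.  Vectors in ℝ^{n1}, ℝ^{n2}
are modeled as `ℕ → ℝ` with relevant indices 1..n1 and 1..n2; the constraint
`max_i lt i ≤ min_j rt j` is expressed as `lt i ≤ rt j` for all relevant i, j.
-/
theorem stmt_9 (n1 n2 : ℕ) (h1 : 1 ≤ n1) (h2 : 1 ≤ n2) (l r : ℕ → ℝ) :
    ∃ c : ℝ,
      -- the clipped pair is feasible:
      (∀ i ∈ Finset.Icc 1 n1, ∀ j ∈ Finset.Icc 1 n2, min c (l i) ≤ max c (r j)) ∧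
      -- and it minimizes the objective over all feasible pairs:
      (∀ lt rt : ℕ → ℝ, (∀ i ∈ Finset.Icc 1 n1, ∀ j ∈ Finset.Icc 1 n2, lt i ≤ rt j) →
        (∑ i ∈ Finset.Icc 1 n1, (l i - min c (l i)) ^ 2) +
          (∑ j ∈ Finset.Icc 1 n2, (r j - max c (r j)) ^ 2) ≤
        (∑ i ∈ Finset.Icc 1 n1, (l i - lt i) ^ 2) +
          (∑ j ∈ Finset.Icc 1 n2, (r j - rt j) ^ 2)) := by
  set I := Finset.Icc 1 n1
  set J := Finset.Icc 1 n2
  obtain ⟨M, hM0, hMl, hMr⟩ : ∃ M : ℝ, 0 ≤ M ∧ (∀ i ∈ I, |l i| ≤ M) ∧ ∀ j ∈ J, |r j| ≤ M := by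
    have hl : 0 ≤ ∑ i ∈ I, |l i| := Finset.sum_nonneg fun _ _ => abs_nonneg _
    have hr : 0 ≤ ∑ j ∈ J, |r j| := Finset.sum_nonneg fun _ _ => abs_nonneg _
    refine ⟨∑ i ∈ I, |l i| + ∑ j ∈ J, |r j|, by linarith, fun i hi => ?_, fun j hj => ?_⟩
    · have := Finset.single_le_sum (f := fun i => |l i|) (fun _ _ => abs_nonneg _) hi
      linarith
    · have := Finset.single_le_sum (f := fun j => |r j|) (fun _ _ => abs_nonneg _) hj
      linarith
  have hcont : Continuous fun c : ℝ =>
      ∑ i ∈ I, (l i - min c (l i)) ^ 2 + ∑ j ∈ J, (r j - max c (r j)) ^ 2 := by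
    fun_prop
  obtain ⟨c, -, hc⟩ := (isCompact_Icc (a := -M) (b := M)).exists_isMinOn
    ⟨0, by constructor <;> linarith⟩ hcont.continuousOn
  refine ⟨c, fun i _ j _ => (min_le_left _ _).trans (le_max_left _ _), fun lt rt hfeas => ?_⟩
  have hI : I.Nonempty := Finset.nonempty_Icc.mpr h1
  obtain ⟨k, hk, hmax⟩ := I.exists_max_image lt hI
  refine (hc (a := max (-M) (min M (lt k)))
    ⟨le_max_left _ _, max_le (by linarith) (min_le_left _ _)⟩).trans ?_
  exact add_le_add
    (Finset.sum_le_sum fun i hi => sq_sub_min_clamp_le (hMl i hi) (hmax i hi))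
    (Finset.sum_le_sum fun j hj => sq_sub_max_clamp_le (hMr j hj) (hfeas k hk j hj))
end

section
/- Let $n_1, n_2 \geq 1$, and let $\ell \in \mathbb{R}^{n_1}$ and $r \in \mathbb{R}^{n_2}$ be sorted in nondecreasing order: $\ell_1 \leq \dots \leq \ell_{n_1}$ and $r_1 \leq \dots \leq r_{n_2}$. Then the minimum of $\sum_{i=1}^{n_1} (\ell_i - \tilde{\ell}_i)^2 + \sum_{j=1}^{n_2} (r_j - \tilde{r}_j)^2$ over pairs $(\tilde{\ell}, \tilde{r})$ satisfying $\max_i \tilde{\ell}_i \leq \min_j \tilde{r}_j$ is equal to the minimum of the same objective over pairs satisfying the chain constraint $\tilde{\ell}_1 \leq \tilde{\ell}_2 \leq \dots \leq \tilde{\ell}_{n_1} \leq \tilde{r}_1 \leq \dots \leq \tilde{r}_{n_2}$. -/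
theorem sq_sub_min_le_sq_sub {x y c : ℝ} (h : y ≤ c) : (x - min x c) ^ 2 ≤ (x - y) ^ 2 := by
  rcases le_total x c with hx | hx
  · rw [min_eq_left hx, sub_self, zero_pow two_ne_zero]
    exact sq_nonneg _
  · rw [min_eq_right hx]
    nlinarith

theorem sq_sub_max_le_sq_sub {x y c : ℝ} (h : c ≤ y) : (x - max x c) ^ 2 ≤ (x - y) ^ 2 := by
  rcases le_total c x with hx | hx
  · rw [max_eq_left hx, sub_self, zero_pow two_ne_zero]
    exact sq_nonneg _
  · rw [max_eq_right hx]
    nlinarith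

/-- The least squared error when the values fitted to `l` lie below `c` and those fitted to `r`
lie above it. -/
noncomputable def thresholdCost (s t : Finset ℕ) (l r : ℕ → ℝ) (c : ℝ) : ℝ :=
  (∑ i ∈ s, (l i - min (l i) c) ^ 2) + ∑ j ∈ t, (r j - max (r j) c) ^ 2

theorem thresholdCost_le {s t : Finset ℕ} {l r lt rt : ℕ → ℝ} {c : ℝ}
    (hlt : ∀ i ∈ s, lt i ≤ c) (hrt : ∀ j ∈ t, c ≤ rt j) :
    thresholdCost s t l r c ≤ (∑ i ∈ s, (l i - lt i) ^ 2) + ∑ j ∈ t, (r j - rt j) ^ 2 :=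
  add_le_add (Finset.sum_le_sum fun i hi => sq_sub_min_le_sq_sub (hlt i hi))
    (Finset.sum_le_sum fun j hj => sq_sub_max_le_sq_sub (hrt j hj))

theorem exists_forall_thresholdCost_le {s t : Finset ℕ} {l r : ℕ → ℝ} {a b : ℝ} (hab : a ≤ b)
    (ha : ∀ j ∈ t, a ≤ r j) (hb : ∀ i ∈ s, l i ≤ b) :
    ∃ c, ∀ d, thresholdCost s t l r c ≤ thresholdCost s t l r d := by
  have hcont : Continuous (thresholdCost s t l r) := by
    unfold thresholdCost
    fun_prop
  obtain ⟨c, -, hc⟩ := isCompact_Icc.exists_isMinOn (Set.nonempty_Icc.2 hab) hcont.continuousOn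
  refine ⟨c, fun d => ?_⟩
  rcases le_total d a with hda | had
  · refine (hc (Set.left_mem_Icc.2 hab)).trans (thresholdCost_le ?_ ?_)
    · exact fun i _ => (min_le_right _ _).trans hda
    · exact fun j hj => (ha j hj).trans (le_max_left _ _)
  rcases le_total d b with hdb | hbd
  · exact hc ⟨had, hdb⟩
  · refine (hc (Set.right_mem_Icc.2 hab)).trans (thresholdCost_le ?_ ?_)
    · exact fun i hi => (min_le_left _ _).trans (hb i hi)
    · exact fun j _ => hbd.trans (le_max_right _ _)

/-
STATEMENT 10: for sorted l and r, the minimum of the squared-error objective under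
the max-min constraint equals the minimum under the chain constraint
lt 1 ≤ … ≤ lt n1 ≤ rt 1 ≤ … ≤ rt n2.  Both minima are attained, expressed via
`IsLeast` with a common value m.
-/
theorem stmt_10 (n1 n2 : ℕ) (h1 : 1 ≤ n1) (h2 : 1 ≤ n2) (l r : ℕ → ℝ)
    (hl : ∀ i j : ℕ, 1 ≤ i → i ≤ j → j ≤ n1 → l i ≤ l j)
    (hr : ∀ i j : ℕ, 1 ≤ i → i ≤ j → j ≤ n2 → r i ≤ r j) :
    ∃ m : ℝ,
      IsLeast {s : ℝ | ∃ lt rt : ℕ → ℝ,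
        (∀ i ∈ Finset.Icc 1 n1, ∀ j ∈ Finset.Icc 1 n2, lt i ≤ rt j) ∧
        s = (∑ i ∈ Finset.Icc 1 n1, (l i - lt i) ^ 2) +
          (∑ j ∈ Finset.Icc 1 n2, (r j - rt j) ^ 2)} m ∧
      IsLeast {s : ℝ | ∃ lt rt : ℕ → ℝ,
        ((∀ i j : ℕ, 1 ≤ i → i ≤ j → j ≤ n1 → lt i ≤ lt j) ∧
         (∀ i j : ℕ, 1 ≤ i → i ≤ j → j ≤ n2 → rt i ≤ rt j) ∧
         lt n1 ≤ rt 1) ∧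
        s = (∑ i ∈ Finset.Icc 1 n1, (l i - lt i) ^ 2) +
          (∑ j ∈ Finset.Icc 1 n2, (r j - rt j) ^ 2)} m := by
  obtain ⟨c, hc⟩ := exists_forall_thresholdCost_le (s := Finset.Icc 1 n1) (t := Finset.Icc 1 n2)
    (l := l) (r := r) (min_le_max : min (r 1) (l n1) ≤ max (r 1) (l n1))
    (fun j hj => (min_le_left _ _).trans
      (hr 1 j le_rfl (Finset.mem_Icc.1 hj).1 (Finset.mem_Icc.1 hj).2))
    (fun i hi => (hl i n1 (Finset.mem_Icc.1 hi).1 (Finset.mem_Icc.1 hi).2 le_rfl).trans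
      (le_max_right _ _))
  have hlower : ∀ lt rt : ℕ → ℝ,
      (∀ i ∈ Finset.Icc 1 n1, ∀ j ∈ Finset.Icc 1 n2, lt i ≤ rt j) →
      thresholdCost (Finset.Icc 1 n1) (Finset.Icc 1 n2) l r c ≤
        (∑ i ∈ Finset.Icc 1 n1, (l i - lt i) ^ 2) +
          (∑ j ∈ Finset.Icc 1 n2, (r j - rt j) ^ 2) := by
    intro lt rt h
    have hne : (Finset.Icc 1 n1).Nonempty := Finset.nonempty_Icc.2 h1
    exact (hc ((Finset.Icc 1 n1).sup' hne lt)).trans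
      (thresholdCost_le (fun i hi => Finset.le_sup' lt hi)
        fun j hj => Finset.sup'_le hne lt fun i hi => h i hi j hj)
  refine ⟨thresholdCost (Finset.Icc 1 n1) (Finset.Icc 1 n2) l r c, ⟨?_, ?_⟩, ?_, ?_⟩
  · exact ⟨fun i => min (l i) c, fun j => max (r j) c,
      fun i _ j _ => (min_le_right _ _).trans (le_max_right _ _), rfl⟩
  · rintro _ ⟨lt, rt, h, rfl⟩
    exact hlower lt rt h
  · exact ⟨fun i => min (l i) c, fun j => max (r j) c,
      ⟨fun i j hi hij hj => min_le_min_right c (hl i j hi hij hj),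
        fun i j hi hij hj => max_le_max_right c (hr i j hi hij hj),
        (min_le_right _ _).trans (le_max_right _ _)⟩, rfl⟩
  · rintro _ ⟨lt, rt, ⟨hlt, hrt, h⟩, rfl⟩
    refine hlower lt rt fun i hi j hj => ?_
    rw [Finset.mem_Icc] at hi hj
    exact (hlt i n1 hi.1 hi.2 le_rfl).trans (h.trans (hrt 1 j le_rfl hj.1 hj.2))
end

section
/- Let $n_1, n_2 \geq 1$, $\ell \in \mathbb{R}^{n_1}$, and $r \in \mathbb{R}^{n_2}$. Then the minimum of $\sum_{i=1}^{n_1} (\ell_i - \tilde{\ell}_i)^2 + \sum_{j=1}^{n_2} (r_j - \tilde{r}_j)^2$ over pairs $(\tilde{\ell}, \tilde{r}) \in \mathbb{R}^{n_1} \times \mathbb{R}^{n_2}$ satisfying $\max_{1 \leq i \leq n_1} \tilde{\ell}_i \leq \min_{1 \leq j \leq n_2} \tilde{r}_j$ equals $\min_{c \in \mathbb{R}} \left[ \sum_{i=1}^{n_1} (\ell_i - \min(c, \ell_i))^2 + \sum_{j=1}^{n_2} (r_j - \max(c, r_j))^2 \right]$, and the latter minimum over $c$ is attained. -/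
theorem sq_sub_min_le {a x c : ℝ} (h : x ≤ c) : (a - min c a) ^ 2 ≤ (a - x) ^ 2 := by
  rcases le_total c a with hc | hc
  · rw [min_eq_left hc]
    nlinarith
  · rw [min_eq_right hc]
    nlinarith [sq_nonneg (a - x)]

theorem sq_sub_max_le {a x c : ℝ} (h : c ≤ x) : (a - max c a) ^ 2 ≤ (a - x) ^ 2 := by
  rcases le_total c a with hc | hc
  · rw [max_eq_right hc]
    nlinarith [sq_nonneg (a - x)]
  · rw [max_eq_left hc]
    nlinarith

/-- The clipped squared error attains its minimum over the clipping level. -/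
theorem exists_forall_clipped_sq_error_le {ι κ : Type*} {s : Finset ι} {t : Finset κ}
    (hs : s.Nonempty) (ht : t.Nonempty) (l : ι → ℝ) (r : κ → ℝ) :
    ∃ c : ℝ, ∀ d : ℝ,
      (∑ i ∈ s, (l i - min c (l i)) ^ 2) + (∑ j ∈ t, (r j - max c (r j)) ^ 2) ≤
        (∑ i ∈ s, (l i - min d (l i)) ^ 2) + (∑ j ∈ t, (r j - max d (r j)) ^ 2) := by
  obtain ⟨i, hi⟩ := hs
  obtain ⟨j, hj⟩ := ht
  set φ : ℝ → ℝ := fun c ↦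
    (∑ i ∈ s, (l i - min c (l i)) ^ 2) + (∑ j ∈ t, (r j - max c (r j)) ^ 2) with hφ
  have hcont : Continuous φ := by fun_prop
  have hl (c : ℝ) : (l i - min c (l i)) ^ 2 ≤ φ c :=
    (Finset.single_le_sum (f := fun i ↦ (l i - min c (l i)) ^ 2)
      (fun _ _ ↦ sq_nonneg _) hi).trans
      (le_add_of_nonneg_right (Finset.sum_nonneg fun _ _ ↦ sq_nonneg _))
  have hr (c : ℝ) : (r j - max c (r j)) ^ 2 ≤ φ c :=
    (Finset.single_le_sum (f := fun j ↦ (r j - max c (r j)) ^ 2)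
      (fun _ _ ↦ sq_nonneg _) hj).trans
      (le_add_of_nonneg_left (Finset.sum_nonneg fun _ _ ↦ sq_nonneg _))
  have h0 : 0 ≤ φ 0 := (sq_nonneg _).trans (hl 0)
  refine hcont.exists_forall_le' 0 ?_
  rw [cocompact_eq_atBot_atTop, Filter.eventually_sup]
  constructor
  · filter_upwards [Filter.eventually_le_atBot (l i - 1 - φ 0)] with c hc
    refine le_trans ?_ (hl c)
    rw [min_eq_left (by linarith)]
    nlinarith
  · filter_upwards [Filter.eventually_ge_atTop (r j + 1 + φ 0)] with c hc
    refine le_trans ?_ (hr c)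
    rw [max_eq_left (by linarith)]
    nlinarith

/-
STATEMENT 12: the minimum of the squared-error objective over pairs satisfying the
max-min constraint equals the minimum over c ∈ ℝ of the clipped objective
φ(c) = Σ_i (l i - min(c, l i))² + Σ_j (r j - max(c, r j))², and the latter minimum
is attained.  Both statements are packaged via `IsLeast` with a common value m.
-/
theorem stmt_12 (n1 n2 : ℕ) (h1 : 1 ≤ n1) (h2 : 1 ≤ n2) (l r : ℕ → ℝ) :
    ∃ m : ℝ,
      IsLeast {s : ℝ | ∃ lt rt : ℕ → ℝ,
        (∀ i ∈ Finset.Icc 1 n1, ∀ j ∈ Finset.Icc 1 n2, lt i ≤ rt j) ∧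
        s = (∑ i ∈ Finset.Icc 1 n1, (l i - lt i) ^ 2) +
          (∑ j ∈ Finset.Icc 1 n2, (r j - rt j) ^ 2)} m ∧
      IsLeast {s : ℝ | ∃ c : ℝ,
        s = (∑ i ∈ Finset.Icc 1 n1, (l i - min c (l i)) ^ 2) +
          (∑ j ∈ Finset.Icc 1 n2, (r j - max c (r j)) ^ 2)} m := by
  have hs : (Finset.Icc 1 n1).Nonempty := Finset.nonempty_Icc.2 h1
  have ht : (Finset.Icc 1 n2).Nonempty := Finset.nonempty_Icc.2 h2
  obtain ⟨c, hc⟩ := exists_forall_clipped_sq_error_le hs ht l r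
  refine ⟨_, ⟨⟨fun i ↦ min c (l i), fun j ↦ max c (r j), fun i _ j _ ↦
    (min_le_left _ _).trans (le_max_left _ _), rfl⟩, ?_⟩, ⟨c, rfl⟩, ?_⟩
  · rintro _ ⟨lt, rt, h, rfl⟩
    refine (hc ((Finset.Icc 1 n1).sup' hs lt)).trans (add_le_add ?_ ?_)
    · exact Finset.sum_le_sum fun i hi ↦ sq_sub_min_le (Finset.le_sup' lt hi)
    · exact Finset.sum_le_sum fun j hj ↦
        sq_sub_max_le (Finset.sup'_le hs lt fun i hi ↦ h i hi j hj)
  · rintro _ ⟨d, rfl⟩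
    exact hc d
end
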